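/- arXiv:2110.04842 — 3 statements merged into one kernel-verified Lean document; each statement's English description precedes it below -/
import Mathlib

section
/- Let d, m ≥ 1. Let Σ be the set of cones of the inner normal fan of the d-dimensional simplex Δ_d = conv(0, e_1, …, e_d) ⊆ ℝ^d, namely the cones cone(S) = { Σ_{s∈S} λ_s s : λ_s ≥ 0 } for proper subsets S ⊊ {e_1, …, e_d, −(e_1+⋯+e_d)}. Then for every v = (v_1, …, v_m) ∈ (ℤ^d)^m and every choice of cones σ_1, …, σ_m ∈ Σ, if the cell C = ⋂_{i=1}^m (−v_i + σ_i) is nonempty, then C contains a point of ℤ^d. -/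
/-- The generators of the (inner) normal fan of the `d`-dimensional simplex
`Δ_d = conv(0, e_1, …, e_d) ⊆ ℝ^d`: the standard basis vectors `e_1, …, e_d`
together with `-(e_1 + ⋯ + e_d)`. -/
noncomputable def simplexGen (d : ℕ) (i : Fin (d + 1)) : Fin d → ℝ :=
  if h : (i : ℕ) < d then Pi.single (⟨i, h⟩ : Fin d) 1 else fun _ => -1

/-- The cone generated by the subset of generators indexed by `S ⊆ Fin (d+1)`:
all nonnegative real linear combinations of the chosen generators. -/
def simplexCone (d : ℕ) (S : Set (Fin (d + 1))) : Set (Fin d → ℝ) :=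
  {x | ∃ c : Fin (d + 1) → ℝ, (∀ i, 0 ≤ c i) ∧ (∀ i, i ∉ S → c i = 0) ∧
    x = ∑ i, c i • simplexGen d i}

/-- Homogeneous coordinates on `ℝ^d`, with last coordinate `0`. -/
def homogCoord {d : ℕ} (x : Fin d → ℝ) : Fin (d + 1) → ℝ :=
  Fin.snoc (α := fun _ => ℝ) x 0

@[simp]
theorem homogCoord_castSucc {d : ℕ} (x : Fin d → ℝ) (j : Fin d) :
    homogCoord x j.castSucc = x j := by
  simp [homogCoord]

@[simp]
theorem homogCoord_last {d : ℕ} (x : Fin d → ℝ) : homogCoord x (Fin.last d) = 0 := by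
  simp [homogCoord]

theorem sum_smul_simplexGen_apply {d : ℕ} (c : Fin (d + 1) → ℝ) (j : Fin d) :
    (∑ i, c i • simplexGen d i) j = c j.castSucc - c (Fin.last d) := by
  simp [Fin.sum_univ_castSucc, simplexGen, Finset.sum_apply, Pi.single_apply, sub_eq_add_neg]

/-- A cone omitting the `k`-th generator is cut out by inequalities and equalities between
homogeneous coordinates. -/
theorem mem_simplexCone_iff {d : ℕ} {S : Set (Fin (d + 1))} {k : Fin (d + 1)} (hk : k ∉ S)
    (x : Fin d → ℝ) :
    x ∈ simplexCone d S ↔ (∀ i, homogCoord x k ≤ homogCoord x i) ∧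
      ∀ i, i ∉ S → homogCoord x i = homogCoord x k := by
  constructor
  · rintro ⟨c, hc, hcS, rfl⟩
    have key (i : Fin (d + 1)) :
        homogCoord (∑ i, c i • simplexGen d i) i = c i - c (Fin.last d) := by
      refine Fin.lastCases ?_ (fun j => ?_) i
      · simp
      · rw [homogCoord_castSucc, sum_smul_simplexGen_apply]
    refine ⟨fun i => ?_, fun i hi => ?_⟩
    · rw [key, key, hcS k hk]
      linarith [hc i]
    · rw [key, key, hcS k hk, hcS i hi]
  · rintro ⟨hle, heq⟩
    refine ⟨fun i => homogCoord x i - homogCoord x k, fun i => sub_nonneg.2 (hle i),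
      fun i hi => sub_eq_zero.2 (heq i hi), ?_⟩
    ext j
    rw [sum_smul_simplexGen_apply]
    simp

theorem homogCoord_floor {d : ℕ} (x : Fin d → ℝ) (i : Fin (d + 1)) :
    homogCoord (fun j => (⌊x j⌋ : ℝ)) i = ⌊homogCoord x i⌋ := by
  refine Fin.lastCases ?_ (fun j => ?_) i <;> simp

/-- Cones of the normal fan of the simplex are stable under rounding down coordinatewise. -/
theorem floor_mem_simplexCone {d : ℕ} {S : Set (Fin (d + 1))} (hS : S ≠ Set.univ)
    {x : Fin d → ℝ} (hx : x ∈ simplexCone d S) :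
    (fun j => (⌊x j⌋ : ℝ)) ∈ simplexCone d S := by
  obtain ⟨k, hk⟩ := (Set.ne_univ_iff_exists_notMem S).1 hS
  rw [mem_simplexCone_iff hk] at hx ⊢
  refine ⟨fun i => ?_, fun i hi => ?_⟩
  · rw [homogCoord_floor, homogCoord_floor]
    exact_mod_cast Int.floor_mono (hx.1 i)
  · rw [homogCoord_floor, homogCoord_floor, hx.2 i hi]

/-- For `P = Δ_d`, every nonempty cell `C = ⋂ᵢ (-vᵢ + σᵢ)` (with `v ∈ (ℤ^d)^m` and
`σᵢ` cones of the normal fan of `Δ_d`) contains an integral point. -/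
theorem stmt_0 (d m : ℕ) (hd : 1 ≤ d) (hm : 1 ≤ m)
    (v : Fin m → Fin d → ℤ)
    (S : Fin m → Set (Fin (d + 1))) (hS : ∀ i, S i ≠ Set.univ)
    (C : Set (Fin d → ℝ))
    (hC : C = ⋂ i, {x : Fin d → ℝ | ((fun j => (v i j : ℝ)) + x) ∈ simplexCone d (S i)})
    (hne : C.Nonempty) :
    ∃ z : Fin d → ℤ, (fun j => (z j : ℝ)) ∈ C := by
  subst hC
  obtain ⟨x, hx⟩ := hne
  refine ⟨fun j => ⌊x j⌋, Set.mem_iInter.2 fun i => ?_⟩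
  have hfloor := floor_mem_simplexCone (hS i) (Set.mem_iInter.1 hx i)
  simpa [Pi.add_def] using hfloor
end

section
/- Let d, m ≥ 1, and let Σ be a collection of subsets of ℝ^d such that ⋃Σ = ℝ^d and {0} ∈ Σ. For v ∈ (ℝ^d)^m define Σ_v := {(τ_1, …, τ_m) ∈ Σ^m : ∃ x ∈ ℝ^d such that v_i + x ∈ τ_i for all i}. If v, w ∈ (ℝ^d)^m satisfy Σ_v = Σ_w, then for every j ∈ {1, …, m} there exists (τ_1, …, τ_m) ∈ Σ^m such that for all i: v_i − v_j ∈ τ_i and w_i − w_j ∈ τ_i. -/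
/-- For a collection `Sig` of subsets of `ℝ^d` and `v = (v_1,…,v_m) ∈ (ℝ^d)^m`,
the set `Σ_v` of tuples `(τ_1,…,τ_m) ∈ Sig^m` such that `v_i + x ∈ τ_i` for all `i`,
for some `x ∈ ℝ^d`. -/
def sigmaTuples (d m : ℕ) (Sig : Set (Set (Fin d → ℝ))) (v : Fin m → Fin d → ℝ) :
    Set (Fin m → Set (Fin d → ℝ)) :=
  {τ | (∀ i, τ i ∈ Sig) ∧ ∃ x : Fin d → ℝ, ∀ i, v i + x ∈ τ i}

/-- If `Sig` covers `ℝ^d` and contains the trivial cone `{0}`, and `Σ_v = Σ_w`, then for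
every `j` there is a tuple `(τ_1,…,τ_m) ∈ Sig^m` with `v_i − v_j ∈ τ_i` and
`w_i − w_j ∈ τ_i` for all `i`. -/
theorem stmt_5 (d m : ℕ) (hd : 1 ≤ d) (hm : 1 ≤ m)
    (Sig : Set (Set (Fin d → ℝ)))
    (hcover : ⋃₀ Sig = Set.univ) (hzero : ({0} : Set (Fin d → ℝ)) ∈ Sig)
    (v w : Fin m → Fin d → ℝ)
    (hvw : sigmaTuples d m Sig v = sigmaTuples d m Sig w) :
    ∀ j : Fin m, ∃ τ : Fin m → Set (Fin d → ℝ),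
      (∀ i, τ i ∈ Sig) ∧ ∀ i, (v i - v j ∈ τ i ∧ w i - w j ∈ τ i) := by
  intro j
  have hex : ∀ i, ∃ t ∈ Sig, v i - v j ∈ t := fun i => by
    have h : v i - v j ∈ ⋃₀ Sig := hcover ▸ Set.mem_univ _
    simpa using h
  choose σ hσ hvσ using hex
  have hτ : ∀ i, Function.update σ j {0} i ∈ Sig ∧
      v i - v j ∈ Function.update σ j {0} i := fun i => by
    rcases eq_or_ne i j with rfl | h
    · simpa using hzero
    · simpa [h] using ⟨hσ i, hvσ i⟩
  have hmem : Function.update σ j {0} ∈ sigmaTuples d m Sig v :=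
    ⟨fun i => (hτ i).1, -v j, fun i => by simpa [sub_eq_add_neg] using (hτ i).2⟩
  rw [hvw] at hmem
  obtain ⟨-, x, hx⟩ := hmem
  have hxj : x = -w j := by
    have h := hx j
    rw [Function.update_self, Set.mem_singleton_iff] at h
    exact eq_neg_of_add_eq_zero_right h
  subst hxj
  exact ⟨_, fun i => (hτ i).1, fun i =>
    ⟨(hτ i).2, by simpa only [sub_eq_add_neg] using hx i⟩⟩
end

section
/- Let Σ be the set of the seven cones of the normal fan of the triangle Δ_2 = conv((0,0), (1,0), (0,1)) ⊆ ℝ^2, namely the cones cone(S) = {Σ_{s∈S} λ_s s : λ_s ≥ 0} for proper subsets S ⊊ {e_1, e_2, −e_1−e_2}. For v = (v_1, v_2) ∈ (ℝ^2)^2 define Σ_v := {(τ_1, τ_2) ∈ Σ^2 : ∃ x ∈ ℝ^2 such that v_1 + x ∈ τ_1 and v_2 + x ∈ τ_2}. Then, with v = (0,0), x = (−1,−2), y = (−2,−1), one has Σ_{(v,x)} ≠ Σ_{(v,y)}, even though −x = (1,2) and −y = (2,1) both lie in the interior of the cone cone({e_1, e_2}) = {(a,b) : a ≥ 0, b ≥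 0}. -/
/-- The generators of the normal fan of the triangle
`Δ_2 = conv((0,0),(1,0),(0,1)) ⊆ ℝ²`: `e_1`, `e_2`, and `−e_1 − e_2`. -/
def triGen : Fin 3 → ℝ × ℝ
  | 0 => (1, 0)
  | 1 => (0, 1)
  | 2 => (-1, -1)

/-- The cone generated by the generators indexed by `S ⊆ Fin 3`: all nonnegative real
linear combinations of the chosen generators. -/
def triCone (S : Set (Fin 3)) : Set (ℝ × ℝ) :=
  {p | ∃ c : Fin 3 → ℝ, (∀ i, 0 ≤ c i) ∧ (∀ i, i ∉ S → c i = 0) ∧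
    p = ∑ i, c i • triGen i}

/-- The set of the seven cones of the normal fan of `Δ_2`. -/
def triFan : Set (Set (ℝ × ℝ)) :=
  {C | ∃ S : Set (Fin 3), S ≠ Set.univ ∧ C = triCone S}

/-- For `(v_1, v_2) ∈ (ℝ²)²`, the set `Σ_{(v_1,v_2)}` of pairs `(τ_1, τ_2)` of cones of the
normal fan of `Δ_2` such that `v_1 + x ∈ τ_1` and `v_2 + x ∈ τ_2` for some `x ∈ ℝ²`. -/
def sigmaPairs (v₁ v₂ : ℝ × ℝ) : Set (Set (ℝ × ℝ) × Set (ℝ × ℝ)) :=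
  {τ | τ.1 ∈ triFan ∧ τ.2 ∈ triFan ∧ ∃ x : ℝ × ℝ, v₁ + x ∈ τ.1 ∧ v₂ + x ∈ τ.2}

theorem mem_triCone_iff (S : Set (Fin 3)) (p : ℝ × ℝ) :
    p ∈ triCone S ↔ ∃ c : Fin 3 → ℝ, (∀ i, 0 ≤ c i) ∧ (∀ i, i ∉ S → c i = 0) ∧
      p.1 = c 0 - c 2 ∧ p.2 = c 1 - c 2 := by
  simp [triCone, Fin.sum_univ_three, triGen, Prod.ext_iff, sub_eq_add_neg]

theorem triCone_singleton_mem_triFan (i : Fin 3) : triCone {i} ∈ triFan :=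
  ⟨{i}, Set.singleton_ne_univ i, rfl⟩

theorem mem_triCone_singleton_one (p : ℝ × ℝ) :
    p ∈ triCone {1} ↔ p.1 = 0 ∧ 0 ≤ p.2 := by
  rw [mem_triCone_iff]
  constructor
  · rintro ⟨c, hc, hS, h1, h2⟩
    have h0 := hS 0 (by simp)
    have h2' := hS 2 (by simp)
    have := hc 1
    constructor <;> linarith
  · rintro ⟨h1, h2⟩
    refine ⟨![0, p.2, 0], ?_, ?_, ?_, ?_⟩ <;> simp [Fin.forall_fin_succ, h1, h2]

theorem mem_triCone_singleton_two (p : ℝ × ℝ) :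
    p ∈ triCone {2} ↔ p.1 = p.2 ∧ p.1 ≤ 0 := by
  rw [mem_triCone_iff]
  constructor
  · rintro ⟨c, hc, hS, h1, h2⟩
    have h0 := hS 0 (by simp)
    have h1' := hS 1 (by simp)
    have := hc 2
    constructor <;> linarith
  · rintro ⟨h1, h2⟩
    refine ⟨![0, 0, -p.1], ?_, ?_, ?_, ?_⟩ <;> simp [Fin.forall_fin_succ, ← h1, h2]

theorem mem_interior_triCone_of_pos {p : ℝ × ℝ} (h1 : 0 < p.1) (h2 : 0 < p.2) :
    p ∈ interior (triCone {0, 1}) := by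
  refine mem_interior.2 ⟨Set.Ioi 0 ×ˢ Set.Ioi 0, ?_, isOpen_Ioi.prod isOpen_Ioi, h1, h2⟩
  rintro q ⟨hq1, hq2⟩
  rw [Set.mem_Ioi] at hq1 hq2
  rw [mem_triCone_iff]
  refine ⟨![q.1, q.2, 0], ?_, ?_, ?_, ?_⟩ <;> simp [Fin.forall_fin_succ, hq1.le, hq2.le]

/-- With `v = (0,0)`, `x = (−1,−2)`, `y = (−2,−1)`, one has `Σ_{(v,x)} ≠ Σ_{(v,y)}`,
even though `−x` and `−y` both lie in the interior of the cone generated by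
`e_1` and `e_2`. -/
theorem stmt_10 :
    sigmaPairs (0, 0) (-1, -2) ≠ sigmaPairs (0, 0) (-2, -1) ∧
    ((1 : ℝ), (2 : ℝ)) ∈ interior (triCone {0, 1}) ∧
    ((2 : ℝ), (1 : ℝ)) ∈ interior (triCone {0, 1}) := by
  refine ⟨fun h => ?_, mem_interior_triCone_of_pos (by norm_num) (by norm_num),
    mem_interior_triCone_of_pos (by norm_num) (by norm_num)⟩
  have hmem : (triCone {1}, triCone {2}) ∈ sigmaPairs (0, 0) (-1, -2) := by
    refine ⟨triCone_singleton_mem_triFan 1, triCone_singleton_mem_triFan 2, (0, 1), ?_, ?_⟩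
    · rw [mem_triCone_singleton_one]
      norm_num
    · rw [mem_triCone_singleton_two]
      norm_num
  rw [h] at hmem
  obtain ⟨-, -, x, h1, h2⟩ := hmem
  rw [mem_triCone_singleton_one] at h1
  rw [mem_triCone_singleton_two] at h2
  simp only [Prod.fst_add, Prod.snd_add] at h1 h2
  linarith [h1.1, h1.2, h2.1]
end
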